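/- arXiv:2404.07728 — 3 statements merged into one kernel-verified Lean document; each statement's English description precedes it below -/
import Mathlib

section
/- For every integer k ≥ 1, c_{2k+1} > 1 and c_{2k+2} < 1. -/
/-- The perturbation `1 / (2 x ^ s)` lies in `(0, 1/2]` for `x ≥ 1` and `s ≥ 0`. -/
lemma one_div_two_mul_rpow_mem_Ioc {x s : ℝ} (hx : 1 ≤ x) (hs : 0 ≤ s) :
    1 / (2 * x ^ s) ∈ Set.Ioc (0 : ℝ) (1 / 2) := by
  have h : 1 ≤ x ^ s := Real.one_le_rpow hx hs
  exact ⟨by positivity, one_div_le_one_div_of_le (by norm_num) (by linarith)⟩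

/-- Composing the odd and the even step multiplies by `(1 - a) / (1 + a) ^ 2`. -/
lemma two_step_eq {A a x : ℝ} (hA : A ≠ 0) (ha : 1 + a ≠ 0) (hx : x ≠ 0) :
    A * (1 - a) / ((1 + a) * (A * (1 + a) / x)) = (1 - a) / (1 + a) ^ 2 * x := by
  field_simp

lemma one_sub_div_one_add_sq_le_one {a : ℝ} (ha : 0 ≤ a) : (1 - a) / (1 + a) ^ 2 ≤ 1 := by
  rw [div_le_one (by positivity)]
  nlinarith

lemma one_div_pi_mul_max_lt_one (r : ℝ) : 1 / (Real.pi * max (r ^ 2) 1) < 1 := by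
  have h : 1 ≤ max (r ^ 2) 1 := le_max_right _ _
  have hpi := Real.pi_gt_three
  rw [div_lt_one (by positivity)]
  nlinarith

lemma one_div_pi_mul_max_lt {r : ℝ} (hr : 0 < r) :
    1 / (Real.pi * max (r ^ 2) 1) < 3 / (2 * Real.pi * r) := by
  have h₁ : 1 ≤ max (r ^ 2) 1 := le_max_right _ _
  have h₂ : r ^ 2 ≤ max (r ^ 2) 1 := le_max_left _ _
  have hpi := Real.pi_pos
  have h : 2 * r < 3 * max (r ^ 2) 1 := by nlinarith [sq_nonneg (r - 1)]
  rw [div_lt_div_iff₀ (by positivity) (by positivity)]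
  nlinarith

/-- Let `w ∈ ℝ²`, `w ≠ 0`, `δ ∈ (0,1)`, and let the sequence `c` satisfy
`c 2 = 1/(π·max(‖w‖²,1))`,
`c (2k+1) = (3/(2π‖w‖))·(1 + 1/(2k^{1+δ}))/c (2k)` and
`c (2k+2) = (3/(2π‖w‖))·(1 − 1/(2k^{1+δ}))/((1 + 1/(2k^{1+δ}))·c (2k+1))` for all `k ≥ 1`.
Then for every `k ≥ 1`, `c (2k+1) > 1` and `c (2k+2) < 1`. -/
theorem c_odd_gt_one_even_lt_one (w : EuclideanSpace ℝ (Fin 2)) (hw : w ≠ 0)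
    (δ : ℝ) (hδ : δ ∈ Set.Ioo (0 : ℝ) 1) (c : ℕ → ℝ)
    (hc2 : c 2 = 1 / (Real.pi * max (‖w‖ ^ 2) 1))
    (hodd : ∀ k : ℕ, 1 ≤ k →
      c (2 * k + 1) = (3 / (2 * Real.pi * ‖w‖)) *
        (1 + 1 / (2 * (k : ℝ) ^ ((1 : ℝ) + δ))) / c (2 * k))
    (heven : ∀ k : ℕ, 1 ≤ k →
      c (2 * k + 2) = (3 / (2 * Real.pi * ‖w‖)) *
        (1 - 1 / (2 * (k : ℝ) ^ ((1 : ℝ) + δ))) /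
          ((1 + 1 / (2 * (k : ℝ) ^ ((1 : ℝ) + δ))) * c (2 * k + 1))) :
    ∀ k : ℕ, 1 ≤ k → 1 < c (2 * k + 1) ∧ c (2 * k + 2) < 1 := by
  have hr : 0 < ‖w‖ := norm_pos_iff.mpr hw
  have hA : 0 < 3 / (2 * Real.pi * ‖w‖) := by positivity
  have ha : ∀ k : ℕ, 1 ≤ k → 1 / (2 * (k : ℝ) ^ ((1 : ℝ) + δ)) ∈ Set.Ioc (0 : ℝ) (1 / 2) :=
    fun k hk => one_div_two_mul_rpow_mem_Ioc (by exact_mod_cast hk) (by linarith [hδ.1])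
  have step : ∀ k : ℕ, 1 ≤ k → 0 < c (2 * k) → 0 < c (2 * k + 2) ∧ c (2 * k + 2) ≤ c (2 * k) := by
    intro k hk hpos
    obtain ⟨ha₀, ha₁⟩ := ha k hk
    rw [heven k hk, hodd k hk, two_step_eq hA.ne' (by linarith) hpos.ne']
    exact ⟨mul_pos (div_pos (by linarith) (by positivity)) hpos,
      mul_le_of_le_one_left hpos.le (one_sub_div_one_add_sq_le_one ha₀.le)⟩
  have even_mem : ∀ k : ℕ, 1 ≤ k → 0 < c (2 * k) ∧ c (2 * k) ≤ c 2 := by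
    intro k hk
    induction k, hk using Nat.le_induction with
    | base => exact ⟨by rw [mul_one, hc2]; positivity, le_rfl⟩
    | succ k hk ih =>
      obtain ⟨hpos, hle⟩ := step k hk ih.1
      exact ⟨hpos, hle.trans ih.2⟩
  intro k hk
  obtain ⟨hpos, hle⟩ := even_mem k hk
  constructor
  · have hlt : c 2 < 3 / (2 * Real.pi * ‖w‖) := hc2 ▸ one_div_pi_mul_max_lt hr
    rw [hodd k hk, one_lt_div hpos]
    exact (hle.trans_lt hlt).trans (lt_mul_of_one_lt_right hA (by linarith [(ha k hk).1]))
  · have hlt : c 2 < 1 := hc2 ▸ one_div_pi_mul_max_lt_one ‖w‖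
    exact ((step k hk hpos).2.trans hle).trans_lt hlt
end

section
/- The sequence (c_{2k+1})_{k≥1} converges to a finite limit L₁ with L₁ > 1, and the sequence (c_{2k+2})_{k≥0} converges to a finite limit L₂ with 0 < L₂ < 1. -/
/-- If `0 ≤ e ≤ 1/2`, then `exp (-4 e) ≤ (1 - e) / (1 + e) ^ 2`. -/
lemma exp_neg_four_mul_le_div {e : ℝ} (h0 : 0 ≤ e) (h1 : e ≤ 1 / 2) :
    Real.exp (-(4 * e)) ≤ (1 - e) / (1 + e) ^ 2 := by
  have hp : (1 + e) ^ 2 ≤ Real.exp (2 * e) := by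
    have h : 1 + e ≤ Real.exp e := by linarith [Real.add_one_le_exp e]
    calc (1 + e) ^ 2 ≤ Real.exp e ^ 2 := by gcongr
      _ = Real.exp (2 * e) := by rw [← Real.exp_nat_mul]; norm_num
  have hm : Real.exp (-(2 * e)) ≤ 1 - e := by
    have h : 1 + 2 * e ≤ Real.exp (2 * e) := by linarith [Real.add_one_le_exp (2 * e)]
    rw [Real.exp_neg, inv_le_iff_one_le_mul₀ (Real.exp_pos _)]
    nlinarith
  rw [le_div_iff₀ (by positivity)]
  calc Real.exp (-(4 * e)) * (1 + e) ^ 2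
      ≤ Real.exp (-(4 * e)) * Real.exp (2 * e) := by gcongr
    _ = Real.exp (-(2 * e)) := by rw [← Real.exp_add]; ring_nf
    _ ≤ 1 - e := hm

/-- A positive sequence with successive ratios `(1 - e n) / (1 + e n) ^ 2`, where `e` is summable
with values in `[0, 1/2]`, has a positive limit, bounded above by its initial value. -/
lemma exists_pos_tendsto_of_ratio {y e : ℕ → ℝ} (hy : 0 < y 0) (h0 : ∀ n, 0 ≤ e n)
    (h1 : ∀ n, e n ≤ 1 / 2) (hs : Summable e)
    (hr : ∀ n, y (n + 1) = (1 - e n) / (1 + e n) ^ 2 * y n) :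
    ∃ L, 0 < L ∧ L ≤ y 0 ∧ Filter.Tendsto y Filter.atTop (nhds L) := by
  have hlow : ∀ n, y 0 * Real.exp (-(4 * ∑ i ∈ Finset.range n, e i)) ≤ y n := by
    intro n
    induction n with
    | zero => simp
    | succ n ih =>
      calc y 0 * Real.exp (-(4 * ∑ i ∈ Finset.range (n + 1), e i))
          = Real.exp (-(4 * e n)) * (y 0 * Real.exp (-(4 * ∑ i ∈ Finset.range n, e i))) := by
            rw [Finset.sum_range_succ, mul_left_comm, ← Real.exp_add]; ring_nf
        _ ≤ (1 - e n) / (1 + e n) ^ 2 * y n :=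
            mul_le_mul (exp_neg_four_mul_le_div (h0 n) (h1 n)) ih (by positivity)
              ((Real.exp_pos _).le.trans (exp_neg_four_mul_le_div (h0 n) (h1 n)))
        _ = y (n + 1) := (hr n).symm
  have hbd : ∀ n, y 0 * Real.exp (-(4 * ∑' i, e i)) ≤ y n := by
    intro n
    refine le_trans ?_ (hlow n)
    gcongr
    exact hs.sum_le_tsum _ fun i _ => h0 i
  have hpos : 0 < y 0 * Real.exp (-(4 * ∑' i, e i)) := by positivity
  have hanti : Antitone y := by
    refine antitone_nat_of_succ_le fun n => ?_
    rw [hr n]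
    refine mul_le_of_le_one_left (hpos.le.trans (hbd n)) ?_
    have := h0 n
    rw [div_le_one (by positivity)]
    nlinarith
  have ht := tendsto_atTop_ciInf hanti ⟨_, Set.forall_mem_range.2 hbd⟩
  exact ⟨_, hpos.trans_le (ge_of_tendsto' ht hbd),
    le_of_tendsto' ht fun n => hanti (Nat.zero_le n), ht⟩

/-- Let `w ∈ ℝ²`, `w ≠ 0`, `δ ∈ (0,1)`, and let the sequence `c` satisfy
`c 2 = 1/(π·max(‖w‖²,1))`,
`c (2k+1) = (3/(2π‖w‖))·(1 + 1/(2k^{1+δ}))/c (2k)` and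
`c (2k+2) = (3/(2π‖w‖))·(1 − 1/(2k^{1+δ}))/((1 + 1/(2k^{1+δ}))·c (2k+1))` for all `k ≥ 1`.
Then `(c (2k+1))_{k≥1}` converges to a finite limit `L₁ > 1` and `(c (2k+2))_{k≥0}`
converges to a finite limit `L₂` with `0 < L₂ < 1`. -/
theorem c_subsequences_converge (w : EuclideanSpace ℝ (Fin 2)) (hw : w ≠ 0)
    (δ : ℝ) (hδ : δ ∈ Set.Ioo (0 : ℝ) 1) (c : ℕ → ℝ)
    (hc2 : c 2 = 1 / (Real.pi * max (‖w‖ ^ 2) 1))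
    (hodd : ∀ k : ℕ, 1 ≤ k →
      c (2 * k + 1) = (3 / (2 * Real.pi * ‖w‖)) *
        (1 + 1 / (2 * (k : ℝ) ^ ((1 : ℝ) + δ))) / c (2 * k))
    (heven : ∀ k : ℕ, 1 ≤ k →
      c (2 * k + 2) = (3 / (2 * Real.pi * ‖w‖)) *
        (1 - 1 / (2 * (k : ℝ) ^ ((1 : ℝ) + δ))) /
          ((1 + 1 / (2 * (k : ℝ) ^ ((1 : ℝ) + δ))) * c (2 * k + 1))) :
    (∃ L₁ : ℝ, 1 < L₁ ∧
      Filter.Tendsto (fun k : ℕ => c (2 * k + 1)) Filter.atTop (nhds L₁)) ∧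
    (∃ L₂ : ℝ, 0 < L₂ ∧ L₂ < 1 ∧
      Filter.Tendsto (fun k : ℕ => c (2 * k + 2)) Filter.atTop (nhds L₂)) := by
  obtain ⟨hδ0, -⟩ := hδ
  have hn : 0 < ‖w‖ := norm_pos_iff.2 hw
  have hπ := Real.pi_gt_three
  set a : ℝ := 3 / (2 * Real.pi * ‖w‖) with ha
  have ha0 : 0 < a := by positivity
  set e : ℕ → ℝ := fun n => 1 / (2 * ((n + 1 : ℕ) : ℝ) ^ ((1 : ℝ) + δ)) with he
  have h0 : ∀ n, 0 ≤ e n := fun n => by positivity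
  have h1 : ∀ n, e n ≤ 1 / 2 := by
    intro n
    have : (1 : ℝ) ≤ ((n + 1 : ℕ) : ℝ) ^ ((1 : ℝ) + δ) :=
      Real.one_le_rpow (by exact_mod_cast Nat.le_add_left 1 n) (by linarith)
    exact one_div_le_one_div_of_le two_pos (by linarith)
  have hs : Summable e := by
    have h := ((summable_nat_add_iff 1).2
      (Real.summable_one_div_nat_rpow.2 (by linarith : 1 < 1 + δ))).mul_left (1 / 2)
    refine h.congr fun n => ?_
    simp only [he]
    ring
  have hodd' : ∀ n, c (2 * (n + 1) + 1) = a * (1 + e n) / c (2 * n + 2) :=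
    fun n => hodd (n + 1) (Nat.le_add_left 1 n)
  have hr : ∀ n, c (2 * (n + 1) + 2) = (1 - e n) / (1 + e n) ^ 2 * c (2 * n + 2) := by
    intro n
    have h : c (2 * (n + 1) + 2) = a * (1 - e n) / ((1 + e n) * c (2 * (n + 1) + 1)) :=
      heven (n + 1) (Nat.le_add_left 1 n)
    have he1 : 1 + e n ≠ 0 := by linarith [h0 n]
    rw [h, hodd' n]
    rcases eq_or_ne (c (2 * n + 2)) 0 with hc | hc
    · simp [hc]
    · field_simp
  have hm : 1 ≤ max (‖w‖ ^ 2) 1 := le_max_right _ _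
  have hc20 : 0 < c 2 := by rw [hc2]; positivity
  obtain ⟨L, hL0, hL, ht⟩ :=
    exists_pos_tendsto_of_ratio (y := fun n => c (2 * n + 2)) hc20 h0 h1 hs hr
  replace hL : L ≤ c 2 := hL
  refine ⟨⟨a / L, ?_, ?_⟩, L, hL0, hL.trans_lt ?_, ht⟩
  · have hmw : ‖w‖ ≤ max (‖w‖ ^ 2) 1 := by
      rcases le_total ‖w‖ 1 with h | h
      · exact h.trans hm
      · exact le_max_of_le_left (by nlinarith)
    rw [one_lt_div hL0]
    refine hL.trans_lt ?_
    rw [hc2, ha, div_lt_div_iff₀ (by positivity) (by positivity)]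
    nlinarith [mul_le_mul_of_nonneg_left hmw Real.pi_pos.le, mul_pos Real.pi_pos hn]
  · rw [← Filter.tendsto_add_atTop_iff_nat 1]
    simp only [hodd']
    have h := ((hs.tendsto_atTop_zero.const_add 1).const_mul a).div ht hL0.ne'
    simpa [Pi.div_def] using h
  · rw [hc2, div_lt_one (by positivity)]
    nlinarith
end

section
/- For every θ ∈ (0,1), every c > 0 and all real numbers a, b with 0 < a ≤ b: ∫_a^b ( u^{−θ/2} − (c + u^θ)^{−1/2} ) du ≤ (√c / (1 − θ)) · ( b^{1−θ} − a^{1−θ} ). -/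
theorem inv_sqrt_sub_inv_sqrt_add_le {c t : ℝ} (hc : 0 ≤ c) (ht : 0 < t) :
    (√t)⁻¹ - (√(c + t))⁻¹ ≤ √c * t⁻¹ := by
  have hx : 0 < √t := Real.sqrt_pos.2 ht
  have hs : √t ≤ √(c + t) := Real.sqrt_le_sqrt (by linarith)
  have hs0 : 0 < √(c + t) := hx.trans_le hs
  have hadd : √(c + t) - √t ≤ √c := by
    rw [sub_le_iff_le_add, Real.sqrt_le_left (by positivity)]
    nlinarith [Real.sq_sqrt hc, Real.sq_sqrt ht.le, mul_nonneg (Real.sqrt_nonneg c) hx.le]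
  calc (√t)⁻¹ - (√(c + t))⁻¹ = (√(c + t) - √t) / (√t * √(c + t)) :=
        inv_sub_inv hx.ne' hs0.ne'
    _ ≤ √c / (√t * √t) := by gcongr
    _ = √c * t⁻¹ := by rw [Real.mul_self_sqrt ht.le, div_eq_mul_inv]

theorem rpow_neg_half_sub_le {θ c u : ℝ} (hc : 0 ≤ c) (hu : 0 < u) :
    u ^ (-θ / 2) - (c + u ^ θ) ^ (-(1 : ℝ) / 2) ≤ √c * u ^ (-θ) := by
  have ht : 0 < u ^ θ := Real.rpow_pos_of_pos hu θ
  have h := inv_sqrt_sub_inv_sqrt_add_le hc ht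
  have h₁ : u ^ (-θ / 2) = (√(u ^ θ))⁻¹ := by
    rw [Real.sqrt_eq_rpow, ← Real.rpow_mul hu.le, ← Real.rpow_neg hu.le]
    ring_nf
  have h₂ : (c + u ^ θ) ^ (-(1 : ℝ) / 2) = (√(c + u ^ θ))⁻¹ := by
    rw [Real.sqrt_eq_rpow, ← Real.rpow_neg (by positivity), neg_div]
  rwa [h₁, h₂, Real.rpow_neg hu.le]

/-- For every `θ ∈ (0,1)`, every `c > 0` and all reals `0 < a ≤ b`,
`∫_a^b (u^{−θ/2} − (c + u^θ)^{−1/2}) du ≤ (√c/(1−θ))·(b^{1−θ} − a^{1−θ})`. -/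
theorem integral_rpow_error_bound (θ : ℝ) (hθ : θ ∈ Set.Ioo (0 : ℝ) 1)
    (c : ℝ) (hc : 0 < c) (a b : ℝ) (ha : 0 < a) (hab : a ≤ b) :
    ∫ u in a..b, (u ^ (-θ / 2) - (c + u ^ θ) ^ (-(1 : ℝ) / 2)) ≤
      Real.sqrt c / (1 - θ) * (b ^ (1 - θ) - a ^ (1 - θ)) := by
  have hpos : ∀ u ∈ Set.uIcc a b, 0 < u := fun u hu =>
    ha.trans_le (Set.uIcc_of_le hab ▸ hu).1
  have hpow (p : ℝ) : ContinuousOn (fun u : ℝ => u ^ p) (Set.uIcc a b) :=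
    continuousOn_id.rpow_const fun u hu => Or.inl (hpos u hu).ne'
  have hshift : ContinuousOn (fun u : ℝ => (c + u ^ θ) ^ (-(1 : ℝ) / 2)) (Set.uIcc a b) :=
    (continuousOn_const.add (hpow θ)).rpow_const fun u hu =>
      Or.inl (add_pos hc (Real.rpow_pos_of_pos (hpos u hu) θ)).ne'
  calc ∫ u in a..b, (u ^ (-θ / 2) - (c + u ^ θ) ^ (-(1 : ℝ) / 2))
      ≤ ∫ u in a..b, √c * u ^ (-θ) :=
        intervalIntegral.integral_mono_on hab ((hpow _).sub hshift).intervalIntegrable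
          (continuousOn_const.mul (hpow _)).intervalIntegrable fun u hu =>
            rpow_neg_half_sub_le hc.le (ha.trans_le hu.1)
    _ = √c / (1 - θ) * (b ^ (1 - θ) - a ^ (1 - θ)) := by
        rw [intervalIntegral.integral_const_mul,
          integral_rpow (Or.inl (by linarith [hθ.2])), neg_add_eq_sub]
        ring
end
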